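/- For any positive integers K, n_maj, n_min, the minimax excess risk over the label shift class P_LS is at least 1/(36K) − (1/2)·E_{S ~ Q_S}[ TV( Σ_{v∈V} Q(v|S)·P_{v,1}, Σ_{v∈V} Q(v|S)·P_{v,−1} ) ], where the hard family P_{v,1}, P_{v,−1}, the joint law Q of (V,S), and the marginal Q_S are as defined in the context. -/

import Mathlib

open MeasureTheory Set
open scoped ENNReal Classical

noncomputable section

/-! ## Basic setup: distributions on `ℝ × Bool`, risk, excess risk.

A labelled example is a pair `(x, y) : ℝ × Bool`, where the label `true` codes `+1`
and `false` codes `-1`; features are supported on `[0,1]`. -/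

/-- The risk (probability of misclassification) of a classifier `f : ℝ → Bool`
under a distribution `P` on `ℝ × Bool`. -/
def risk (f : ℝ → Bool) (P : Measure (ℝ × Bool)) : ℝ :=
  (P {p : ℝ × Bool | f p.1 ≠ p.2}).toReal

/-- The Bayes risk of a distribution: the infimum of the risk over all classifiers. -/
def bayesRisk (P : Measure (ℝ × Bool)) : ℝ :=
  ⨅ f : ℝ → Bool, risk f P

/-- The balanced test distribution `P_test = (1/2) P_maj + (1/2) P_min`. -/
def testMeasure (Pmaj Pmin : Measure (ℝ × Bool)) : Measure (ℝ × Bool) :=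
  (2 : ℝ≥0∞)⁻¹ • Pmaj + (2 : ℝ≥0∞)⁻¹ • Pmin

/-- A training sample: `nmaj` labelled points from the majority distribution and
`nmin` labelled points from the minority distribution. -/
abbrev Sample (nmaj nmin : ℕ) : Type :=
  (Fin nmaj → ℝ × Bool) × (Fin nmin → ℝ × Bool)

/-- The law `P_maj^{n_maj} × P_min^{n_min}` of the training sample. -/
def sampleMeasure (nmaj nmin : ℕ) (Pmaj Pmin : Measure (ℝ × Bool)) :
    Measure (Sample nmaj nmin) :=
  (Measure.pi fun _ : Fin nmaj => Pmaj).prod (Measure.pi fun _ : Fin nmin => Pmin)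

/-- An algorithm (a map from samples to classifiers) is measurable if the joint map
`(S, x) ↦ A S x` is measurable. -/
def MeasurableAlg (nmaj nmin : ℕ) (A : Sample nmaj nmin → ℝ → Bool) : Prop :=
  Measurable fun p : Sample nmaj nmin × ℝ => A p.1 p.2

/-- The expected excess risk of the algorithm `A` on the pair `(P_maj, P_min)`:
`E_{S ~ P_maj^{n_maj} × P_min^{n_min}}[R(A^S; P_test)] - R(f^*; P_test)`. -/
def excessRisk (nmaj nmin : ℕ) (A : Sample nmaj nmin → ℝ → Bool)
    (Pmaj Pmin : Measure (ℝ × Bool)) : ℝ :=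
  (∫ S, risk (A S) (testMeasure Pmaj Pmin) ∂sampleMeasure nmaj nmin Pmaj Pmin)
    - bayesRisk (testMeasure Pmaj Pmin)

/-- The distribution on `ℝ × Bool` supported on label `y` whose feature has density `p`
(w.r.t. Lebesgue measure) on `[0,1]`. -/
def labelMeasure (p : ℝ → ℝ) (y : Bool) : Measure (ℝ × Bool) :=
  Measure.map (fun x => (x, y))
    ((volume.restrict (Icc (0:ℝ) 1)).withDensity fun x => ENNReal.ofReal (p x))

/-- The label-shift class `𝒫_LS`: `P_maj(x,y) = P₁(x)·1{y = 1}`,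
`P_min(x,y) = P₋₁(x)·1{y = -1}` with `P₁, P₋₁` 1-Lipschitz densities on `[0,1]`. -/
def memLS (Pmaj Pmin : Measure (ℝ × Bool)) : Prop :=
  ∃ p1 pm1 : ℝ → ℝ,
    (∀ x, 0 ≤ p1 x) ∧ (∀ x, 0 ≤ pm1 x) ∧
    LipschitzOnWith 1 p1 (Icc 0 1) ∧ LipschitzOnWith 1 pm1 (Icc 0 1) ∧
    (∫ x in Icc (0:ℝ) 1, p1 x) = 1 ∧ (∫ x in Icc (0:ℝ) 1, pm1 x) = 1 ∧
    Pmaj = labelMeasure p1 true ∧ Pmin = labelMeasure pm1 false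

/-- Total variation distance between two densities on `[0,1]`:
`TV(p, q) = (1/2)∫₀¹ |p - q|`. -/
def tvDist (p q : ℝ → ℝ) : ℝ :=
  (1/2) * ∫ x in Icc (0:ℝ) 1, |p x - q x|

/-- The distribution on `ℝ × Bool` whose feature has density `p` on `[0,1]` and whose
label is `true` with probability `η x` conditionally on the feature `x`. -/
def covMeasure (p η : ℝ → ℝ) : Measure (ℝ × Bool) :=
  labelMeasure (fun x => p x * η x) true + labelMeasure (fun x => p x * (1 - η x)) false

/-- The group-covariate shift class `𝒫_GS(τ)`: `P_maj(x,y) = P_a(x)·P(y|x)`,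
`P_min(x,y) = P_b(x)·P(y|x)` with group densities `P_a, P_b` on `[0,1]`,
a shared 1-Lipschitz conditional label distribution, and overlap
`1 - TV(P_a, P_b) ≥ τ`. -/
def memGS (τ : ℝ) (Pmaj Pmin : Measure (ℝ × Bool)) : Prop :=
  ∃ pa pb η : ℝ → ℝ,
    (∀ x, 0 ≤ pa x) ∧ (∀ x, 0 ≤ pb x) ∧
    (∫ x in Icc (0:ℝ) 1, pa x) = 1 ∧ (∫ x in Icc (0:ℝ) 1, pb x) = 1 ∧
    (∀ x, 0 ≤ η x ∧ η x ≤ 1) ∧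
    LipschitzOnWith 1 η (Icc 0 1) ∧ LipschitzOnWith 1 (fun x => 1 - η x) (Icc 0 1) ∧
    τ ≤ 1 - tvDist pa pb ∧
    Pmaj = covMeasure pa η ∧ Pmin = covMeasure pb η

/-! ## The hat function -/

/-- The hat function `φ_K`. -/
def hatFun (K : ℕ) (x : ℝ) : ℝ :=
  if x ∈ Icc (-(1/(2*(K:ℝ)))) 0 then |x + 1/(4*(K:ℝ))| - 1/(4*(K:ℝ))
  else if x ∈ Icc (0:ℝ) (1/(2*(K:ℝ))) then 1/(4*(K:ℝ)) - |x - 1/(4*(K:ℝ))|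
  else 0

/-! ## The hard family for the label-shift lower bound.

Bins are 0-indexed: `I_j = [j/K, (j+1)/K)` for `j = 0, …, K-1`, corresponding to the
paper's `I_{j+1} = [((j+1)-1)/K, (j+1)/K]`; the bin center is `(j + 1/2)/K`. -/

/-- The value in `{-1, 0, 1}` coded by an element of `Fin 3`. -/
def trit (i : Fin 3) : ℝ := (i : ℝ) - 1

/-- The perturbed density of the hard label-shift family: on the bin
`I_j = [j/K, (j+1)/K)` it equals `1 + v_j · φ_K(x - (j + 1/2)/K)`. -/
def hardDensityLS (K : ℕ) (v : Fin K → Fin 3) (x : ℝ) : ℝ :=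
  1 + ∑ j : Fin K,
    (if x ∈ Ico ((j:ℝ)/(K:ℝ)) (((j:ℝ)+1)/(K:ℝ))
      then trit (v j) * hatFun K (x - ((j:ℝ) + 1/2)/(K:ℝ)) else 0)

/-- The index set `𝒱 = {-1,0,1}^K × {-1,0,1}^K` of the hard label-shift family. -/
abbrev TritPair (K : ℕ) : Type := (Fin K → Fin 3) × (Fin K → Fin 3)

/-- The law `Q(S | v) = P_{v,maj}^{n_maj} × P_{v,min}^{n_min}` of the sample for the hard
label-shift instance indexed by `v`. -/
def hardLSMeasure (K nmaj nmin : ℕ) (v : TritPair K) : Measure (Sample nmaj nmin) :=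
  sampleMeasure nmaj nmin (labelMeasure (hardDensityLS K v.1) true)
    (labelMeasure (hardDensityLS K v.2) false)

/-- The marginal law `Q_S` of the sample when the index `V` is uniform on `𝒱`. -/
def hardLSMarginal (K nmaj nmin : ℕ) : Measure (Sample nmaj nmin) :=
  ∑ v : TritPair K, (Fintype.card (TritPair K) : ℝ≥0∞)⁻¹ • hardLSMeasure K nmaj nmin v

/-- The posterior weight `Q(v | S)`: the Radon–Nikodym derivative of
`(1/|𝒱|) · Q(S | v)` with respect to `Q_S`, evaluated at `S`. -/
def postLS (K nmaj nmin : ℕ) (v : TritPair K) (S : Sample nmaj nmin) : ℝ :=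
  (((Fintype.card (TritPair K) : ℝ≥0∞)⁻¹ • hardLSMeasure K nmaj nmin v).rnDeriv
      (hardLSMarginal K nmaj nmin) S).toReal

/-- The posterior mixture density `Σ_{v ∈ 𝒱} Q(v | S) · P_{v, ±1}`;
`cls = true` selects the class `+1` densities `P_{v,1}`. -/
def postMixLS (K nmaj nmin : ℕ) (S : Sample nmaj nmin) (cls : Bool) (x : ℝ) : ℝ :=
  ∑ v : TritPair K,
    postLS K nmaj nmin v S * hardDensityLS K (if cls then v.1 else v.2) x

/-! ## The hard family for the group-covariate shift lower bound -/

/-- The sign `+1` / `-1` coded by a Bool. -/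
def sgnB (b : Bool) : ℝ := if b then 1 else -1

/-- `P_v(y = 1 | x)` for the hard group-shift family: on the bin `I_j = [j/K, (j+1)/K)` it
equals `(1/2)(1 + v_j · φ_K(x - (j+1/2)/K))`. -/
def hardEta (K : ℕ) (v : Fin K → Bool) (x : ℝ) : ℝ :=
  (1/2) * (1 + ∑ j : Fin K,
    (if x ∈ Ico ((j:ℝ)/(K:ℝ)) (((j:ℝ)+1)/(K:ℝ))
      then sgnB (v j) * hatFun K (x - ((j:ℝ) + 1/2)/(K:ℝ)) else 0))

/-- The majority-group feature density: `2 - τ` on `[0, 1/2)` and `τ` on `[1/2, 1]`. -/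
def hardPa (τ : ℝ) (x : ℝ) : ℝ := if x < 1/2 then 2 - τ else τ

/-- The minority-group feature density `P_b = 2 - P_a`. -/
def hardPb (τ : ℝ) (x : ℝ) : ℝ := 2 - hardPa τ x

/-- The law `Q(S | v)` of the sample for the hard group-shift instance indexed by `v`. -/
def hardGSMeasure (K nmaj nmin : ℕ) (τ : ℝ) (v : Fin K → Bool) :
    Measure (Sample nmaj nmin) :=
  sampleMeasure nmaj nmin (covMeasure (hardPa τ) (hardEta K v))
    (covMeasure (hardPb τ) (hardEta K v))

/-- The conditional law `Q(S | v_j = b)` of the sample given the `j`-th coordinate of the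
uniformly random index: the uniform mixture over all `v` with `v_j = b`. -/
def condGS (K nmaj nmin : ℕ) (τ : ℝ) (j : Fin K) (b : Bool) :
    Measure (Sample nmaj nmin) :=
  ((Finset.univ.filter fun v : Fin K → Bool => v j = b).card : ℝ≥0∞)⁻¹ •
    ∑ v ∈ Finset.univ.filter (fun v : Fin K → Bool => v j = b),
      hardGSMeasure K nmaj nmin τ v

/-- The Kullback–Leibler divergence `KL(μ ‖ ν) = ∫ log (dμ/dν) dμ`. -/
def klDiv' {α : Type*} [MeasurableSpace α] (μ ν : Measure α) : ℝ :=
  ∫ x, Real.log ((μ.rnDeriv ν x).toReal) ∂μ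

/-! ## The undersampled binning estimator -/

/-- The prediction of the undersampled binning estimator on the bin `I_j = [j/K, (j+1)/K)`
(0-indexed), where `s ⊆ Fin nmaj` is the set of retained majority samples: predict `+1`
iff the samples of the undersampled dataset in the bin with label `+1` strictly
outnumber those with label `-1`. -/
def usbBinPred (nmaj nmin K : ℕ) (s : Finset (Fin nmaj)) (S : Sample nmaj nmin)
    (j : ℕ) : Bool :=
  decide
    ((s.filter fun i => (S.1 i).2 = false ∧
        (S.1 i).1 ∈ Ico ((j:ℝ)/(K:ℝ)) (((j:ℝ)+1)/(K:ℝ))).card +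
      (Finset.univ.filter fun i : Fin nmin => (S.2 i).2 = false ∧
        (S.2 i).1 ∈ Ico ((j:ℝ)/(K:ℝ)) (((j:ℝ)+1)/(K:ℝ))).card
      <
      (s.filter fun i => (S.1 i).2 = true ∧
        (S.1 i).1 ∈ Ico ((j:ℝ)/(K:ℝ)) (((j:ℝ)+1)/(K:ℝ))).card +
      (Finset.univ.filter fun i : Fin nmin => (S.2 i).2 = true ∧
        (S.2 i).1 ∈ Ico ((j:ℝ)/(K:ℝ)) (((j:ℝ)+1)/(K:ℝ))).card)

/-- The undersampled binning classifier `A_USB^{S,K}` with `K` bins, given the retained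
majority samples `s`: on each bin it predicts the majority label among the undersampled
data in that bin. -/
def usbClassifier (nmaj nmin K : ℕ) (s : Finset (Fin nmaj)) (S : Sample nmaj nmin) :
    ℝ → Bool :=
  fun x => usbBinPred nmaj nmin K s S (min ⌊x * (K:ℝ)⌋₊ (K - 1))

/-- The expected excess risk of the undersampled binning estimator with `K` bins, where the
`nmin` retained majority samples are drawn uniformly at random without replacement
(uniformly among all subsets of size `nmin`). -/
def usbExcessRisk (nmaj nmin K : ℕ) (Pmaj Pmin : Measure (ℝ × Bool)) : ℝ :=
  (∑ s ∈ Finset.powersetCard nmin (Finset.univ : Finset (Fin nmaj)),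
      ∫ S, risk (usbClassifier nmaj nmin K s S) (testMeasure Pmaj Pmin)
        ∂sampleMeasure nmaj nmin Pmaj Pmin)
    / ((Finset.powersetCard nmin (Finset.univ : Finset (Fin nmaj))).card : ℝ)
  - bayesRisk (testMeasure Pmaj Pmin)

/-- `q_{j,y} = P(y | x ∈ I_j)` for the 0-indexed bin `I_j = [j/K, (j+1)/K)`. -/
def qBin (P : Measure (ℝ × Bool)) (K j : ℕ) (y : Bool) : ℝ :=
  (P ((Ico ((j:ℝ)/(K:ℝ)) (((j:ℝ)+1)/(K:ℝ))) ×ˢ ({y} : Set Bool))).toReal /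
    (P ((Ico ((j:ℝ)/(K:ℝ)) (((j:ℝ)+1)/(K:ℝ))) ×ˢ (univ : Set Bool))).toReal

/-- The excess risk of the binning estimator in the bin `I_j`:
`R_j(A_USB^S) = q_{j, -A_j^S} - min{q_{j,1}, q_{j,-1}}`. -/
def binExcess (nmaj nmin K : ℕ) (s : Finset (Fin nmaj)) (S : Sample nmaj nmin)
    (P : Measure (ℝ × Bool)) (j : ℕ) : ℝ :=
  qBin P K j (!(usbBinPred nmaj nmin K s S j)) - min (qBin P K j true) (qBin P K j false)

/-- The binomial probability mass function `P[Bin(m, p) = k]`. -/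
def binomPMF (m : ℕ) (p : ℝ) (k : ℕ) : ℝ :=
  (m.choose k : ℝ) * p ^ k * (1 - p) ^ (m - k)

theorem abs_trit_le_one (i : Fin 3) : |trit i| ≤ 1 := by
  fin_cases i <;> norm_num [trit]

/-- The hat function in terms of the height `a` of its two peaks. -/
theorem hatFun_eq {K : ℕ} {a : ℝ} (ha : a = 1 / (4 * (K : ℝ))) (x : ℝ) :
    hatFun K x =
      if x ∈ Icc (-(2 * a)) 0 then |x + a| - a
      else if x ∈ Icc 0 (2 * a) then a - |x - a| else 0 := by
  have h2 : 1 / (2 * (K : ℝ)) = 2 * a := by rw [ha]; ring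
  rw [hatFun, h2, ← ha]

theorem abs_hatFun_sub_le (K : ℕ) (x y : ℝ) : |hatFun K x - hatFun K y| ≤ |x - y| := by
  have ha0 : (0 : ℝ) ≤ 1 / (4 * (K : ℝ)) := by positivity
  rw [hatFun_eq rfl, hatFun_eq rfl]
  generalize 1 / (4 * (K : ℝ)) = a at ha0
  simp only [mem_Icc]
  split_ifs <;> grind

theorem abs_hatFun_le {K : ℕ} {r : ℝ} (x : ℝ) (hr : 1 / (2 * (K : ℝ)) - |x| ≤ r) (hr0 : 0 ≤ r) :
    |hatFun K x| ≤ r := by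
  have ha0 : (0 : ℝ) ≤ 1 / (4 * (K : ℝ)) := by positivity
  have h2 : 1 / (2 * (K : ℝ)) = 2 * (1 / (4 * (K : ℝ))) := by ring
  rw [h2] at hr
  rw [hatFun_eq rfl]
  generalize 1 / (4 * (K : ℝ)) = a at *
  simp only [mem_Icc]
  split_ifs <;> grind

theorem abs_hatFun_le_quarter {K : ℕ} (hK : 0 < K) (x : ℝ) : |hatFun K x| ≤ 1 / 4 := by
  have hK1 : (1 : ℝ) ≤ K := by exact_mod_cast hK
  have ha0 : (0 : ℝ) ≤ 1 / (4 * (K : ℝ)) := by positivity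
  have ha1 : 1 / (4 * (K : ℝ)) ≤ 1 / 4 := by
    apply one_div_le_one_div_of_le <;> linarith
  rw [hatFun_eq rfl]
  generalize 1 / (4 * (K : ℝ)) = a at *
  simp only [mem_Icc]
  split_ifs <;> grind

theorem hatFun_neg (K : ℕ) (x : ℝ) : hatFun K (-x) = -hatFun K x := by
  have ha0 : (0 : ℝ) ≤ 1 / (4 * (K : ℝ)) := by positivity
  rw [hatFun_eq rfl, hatFun_eq rfl]
  generalize 1 / (4 * (K : ℝ)) = a at *
  simp only [mem_Icc]
  split_ifs <;> grind

theorem continuous_hatFun (K : ℕ) : Continuous (hatFun K) := by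
  have h : LipschitzWith 1 (hatFun K) := LipschitzWith.of_dist_le_mul fun x y => by
    simpa [Real.dist_eq] using abs_hatFun_sub_le K x y
  exact h.continuous

theorem integral_hatFun (K : ℕ) :
    ∫ x in (-(1 / (2 * (K : ℝ))))..(1 / (2 * (K : ℝ))), hatFun K x = 0 := by
  have h := intervalIntegral.integral_comp_neg
    (a := -(1 / (2 * (K : ℝ)))) (b := 1 / (2 * (K : ℝ))) (hatFun K)
  simp only [hatFun_neg, intervalIntegral.integral_neg, neg_neg] at h
  linarith

theorem integral_abs_hatFun (K : ℕ) :
    ∫ x in (-(1 / (2 * (K : ℝ))))..(1 / (2 * (K : ℝ))), |hatFun K x| = 1 / (8 * (K : ℝ) ^ 2) := by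
  have ha0 : (0 : ℝ) ≤ 1 / (4 * (K : ℝ)) := by positivity
  have h2 : 1 / (2 * (K : ℝ)) = 2 * (1 / (4 * (K : ℝ))) := by ring
  have h8 : 1 / (8 * (K : ℝ) ^ 2) = 2 * (1 / (4 * (K : ℝ))) ^ 2 := by ring
  have hc : Continuous fun x => |hatFun K x| := (continuous_hatFun K).abs
  have heven := intervalIntegral.integral_comp_neg
    (a := 0) (b := 1 / (2 * (K : ℝ))) fun x => |hatFun K x|
  simp only [hatFun_neg, abs_neg, neg_zero] at heven
  rw [← intervalIntegral.integral_add_adjacent_intervals (hc.intervalIntegrable _ 0)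
    (hc.intervalIntegrable 0 _), ← heven, h2, h8,
    ← intervalIntegral.integral_add_adjacent_intervals
      (hc.intervalIntegrable _ (1 / (4 * (K : ℝ)))) (hc.intervalIntegrable _ _)]
  have e1 : ∫ x in (0 : ℝ)..(1 / (4 * (K : ℝ))), |hatFun K x| =
      ∫ x in (0 : ℝ)..(1 / (4 * (K : ℝ))), x := by
    apply intervalIntegral.integral_congr
    intro x hx
    rw [uIcc_of_le ha0] at hx
    simp only
    rw [hatFun_eq rfl]
    generalize 1 / (4 * (K : ℝ)) = a at *
    simp only [mem_Icc] at *
    split_ifs <;> grind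
  have e2 : ∫ x in (1 / (4 * (K : ℝ)))..(2 * (1 / (4 * (K : ℝ)))), |hatFun K x| =
      ∫ x in (1 / (4 * (K : ℝ)))..(2 * (1 / (4 * (K : ℝ)))), (2 * (1 / (4 * (K : ℝ))) - x) := by
    apply intervalIntegral.integral_congr
    intro x hx
    rw [uIcc_of_le (by linarith)] at hx
    simp only
    rw [hatFun_eq rfl]
    generalize 1 / (4 * (K : ℝ)) = a at *
    simp only [mem_Icc] at *
    split_ifs <;> grind
  rw [e1, e2, intervalIntegral.integral_sub (by simp) (by simp)]
  simp only [integral_id, intervalIntegral.integral_const, smul_eq_mul]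
  ring

/-- The `j`-th of the `K` half-open bins of equal length in `[0,1)`. -/
def unitBin (K j : ℕ) : Set ℝ := Ico ((j : ℝ) / (K : ℝ)) (((j : ℝ) + 1) / (K : ℝ))

theorem measurableSet_unitBin (K j : ℕ) : MeasurableSet (unitBin K j) := measurableSet_Ico

theorem mem_unitBin {K j : ℕ} (hK : 0 < K) {x : ℝ} :
    x ∈ unitBin K j ↔ (j : ℝ) ≤ x * K ∧ x * K < (j : ℝ) + 1 := by
  have hK0 : (0 : ℝ) < K := by exact_mod_cast hK
  rw [unitBin, mem_Ico, div_le_iff₀ hK0, lt_div_iff₀ hK0]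

theorem eq_of_mem_unitBin {K i j : ℕ} (hK : 0 < K) {x : ℝ} (hi : x ∈ unitBin K i)
    (hj : x ∈ unitBin K j) : i = j := by
  rw [mem_unitBin hK] at hi hj
  have h1 : (i : ℝ) < (j : ℝ) + 1 := by linarith
  have h2 : (j : ℝ) < (i : ℝ) + 1 := by linarith
  norm_cast at h1 h2
  omega

theorem unitBin_subset_Icc {K : ℕ} (hK : 0 < K) (j : Fin K) : unitBin K j ⊆ Icc 0 1 := by
  have hK0 : (0 : ℝ) < K := by exact_mod_cast hK
  have hj : ((j : ℕ) : ℝ) + 1 ≤ K := by exact_mod_cast j.2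
  intro x hx
  rw [mem_unitBin hK] at hx
  constructor
  · by_contra! h
    nlinarith [Nat.cast_nonneg (α := ℝ) (j : ℕ)]
  · by_contra! h
    nlinarith

theorem exists_mem_unitBin {K : ℕ} (hK : 0 < K) {x : ℝ} (h0 : 0 ≤ x) (h1 : x < 1) :
    ∃ j : Fin K, x ∈ unitBin K j := by
  have hK0 : (0 : ℝ) < K := by exact_mod_cast hK
  have hx : 0 ≤ x * K := by positivity
  refine ⟨⟨⌊x * K⌋₊, (Nat.floor_lt hx).2 (by nlinarith)⟩, ?_⟩
  rw [mem_unitBin hK]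
  exact ⟨Nat.floor_le hx, Nat.lt_floor_add_one _⟩

theorem sum_unitBin_of_mem {K : ℕ} (hK : 0 < K) (F : Fin K → ℝ → ℝ) {x : ℝ} {j : Fin K}
    (hx : x ∈ unitBin K j) : (∑ i : Fin K, if x ∈ unitBin K i then F i x else 0) = F j x := by
  rw [Finset.sum_eq_single j, if_pos hx]
  · intro i _ hij
    exact if_neg fun hi => hij (Fin.ext (eq_of_mem_unitBin hK hi hx))
  · simp

/-- The absolute value passes inside a sum over bins, as at most one summand is nonzero. -/
theorem abs_sum_unitBin {K : ℕ} (hK : 0 < K) (F : Fin K → ℝ → ℝ) (x : ℝ) :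
    |∑ i : Fin K, if x ∈ unitBin K i then F i x else 0| =
      ∑ i : Fin K, if x ∈ unitBin K i then |F i x| else 0 := by
  by_cases h : ∃ j : Fin K, x ∈ unitBin K j
  · obtain ⟨j, hj⟩ := h
    rw [sum_unitBin_of_mem hK F hj, sum_unitBin_of_mem hK (fun i x => |F i x|) hj]
  · push Not at h
    simp [h]

/-- The center of the `j`-th bin. -/
def binCenter (K j : ℕ) : ℝ := ((j : ℝ) + 1 / 2) / (K : ℝ)

theorem hardDensityLS_eq (K : ℕ) (v : Fin K → Fin 3) (x : ℝ) :
    hardDensityLS K v x = 1 + ∑ j : Fin K,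
      if x ∈ unitBin K j then trit (v j) * hatFun K (x - binCenter K j) else 0 := by
  rw [hardDensityLS]
  refine congrArg _ (Finset.sum_congr rfl fun j _ => ?_)
  congr 1

theorem hardDensityLS_of_mem {K : ℕ} (hK : 0 < K) (v : Fin K → Fin 3) {x : ℝ} {j : Fin K}
    (hx : x ∈ unitBin K j) :
    hardDensityLS K v x = 1 + trit (v j) * hatFun K (x - binCenter K j) := by
  rw [hardDensityLS_eq,
    sum_unitBin_of_mem hK (fun j x => trit (v j) * hatFun K (x - binCenter K j)) hx]

theorem hardDensityLS_of_notMem {K : ℕ} (v : Fin K → Fin 3) {x : ℝ}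
    (hx : ∀ j : Fin K, x ∉ unitBin K j) : hardDensityLS K v x = 1 := by
  simp [hardDensityLS_eq, hx]

theorem abs_hardDensityLS_sub_one_le {K : ℕ} (hK : 0 < K) (v : Fin K → Fin 3) (x : ℝ) :
    |hardDensityLS K v x - 1| ≤ 1 / 4 := by
  by_cases h : ∃ j : Fin K, x ∈ unitBin K j
  · obtain ⟨j, hj⟩ := h
    rw [hardDensityLS_of_mem hK v hj, add_sub_cancel_left, abs_mul]
    have h1 := abs_trit_le_one (v j)
    have h2 := abs_hatFun_le_quarter hK (x - binCenter K j)
    nlinarith [abs_nonneg (trit (v j)), abs_nonneg (hatFun K (x - binCenter K j))]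
  · push Not at h
    rw [hardDensityLS_of_notMem v h]
    norm_num

theorem hardDensityLS_nonneg {K : ℕ} (hK : 0 < K) (v : Fin K → Fin 3) (x : ℝ) :
    0 ≤ hardDensityLS K v x := by
  linarith [abs_le.1 (abs_hardDensityLS_sub_one_le hK v x)]

/-- The perturbation is dominated by the distance to any bin boundary. -/
theorem abs_hardDensityLS_sub_one_le_dist {K : ℕ} (hK : 0 < K) (v : Fin K → Fin 3) (x : ℝ)
    (m : ℕ) : |hardDensityLS K v x - 1| ≤ |x - (m : ℝ) / K| := by
  have hK0 : (0 : ℝ) < K := by exact_mod_cast hK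
  by_cases h : ∃ j : Fin K, x ∈ unitBin K j
  · obtain ⟨j, hj⟩ := h
    rw [hardDensityLS_of_mem hK v hj, add_sub_cancel_left, abs_mul]
    have h1 := abs_trit_le_one (v j)
    have h2 : |hatFun K (x - binCenter K j)| ≤ |x - (m : ℝ) / K| := by
      apply abs_hatFun_le _ _ (abs_nonneg _)
      have e1 : binCenter K j = (j : ℕ) / (K : ℝ) + 1 / (2 * K) := by
        rw [binCenter]; ring
      have e2 : 1 / (K : ℝ) = 2 * (1 / (2 * K)) := by ring
      rw [unitBin, mem_Ico, add_div, e2] at hj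
      rw [e1]
      rcases Nat.lt_or_ge (j : ℕ) m with hm | hm
      · have hm' : ((j : ℕ) : ℝ) + 1 ≤ m := by exact_mod_cast hm
        have := div_le_div_of_nonneg_right hm' hK0.le
        rw [add_div, e2] at this
        grind
      · have hm' : (m : ℝ) ≤ (j : ℕ) := by exact_mod_cast hm
        have := div_le_div_of_nonneg_right hm' hK0.le
        grind
    nlinarith [abs_nonneg (trit (v j)), abs_nonneg (hatFun K (x - binCenter K j))]
  · push Not at h
    rw [hardDensityLS_of_notMem v h]
    simp

theorem abs_hardDensityLS_sub_le {K : ℕ} (hK : 0 < K) (v : Fin K → Fin 3) {x y : ℝ}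
    (hx : x ∈ Icc (0 : ℝ) 1) (hy : y ∈ Icc (0 : ℝ) 1) (hxy : x ≤ y) :
    |hardDensityLS K v x - hardDensityLS K v y| ≤ |x - y| := by
  rcases hx.2.lt_or_eq with hx1 | hx1
  · obtain ⟨j, hj⟩ := exists_mem_unitBin hK hx.1 hx1
    by_cases hyj : y ∈ unitBin K j
    · rw [hardDensityLS_of_mem hK v hj, hardDensityLS_of_mem hK v hyj, add_sub_add_left_eq_sub,
        ← mul_sub, abs_mul]
      have h1 := abs_trit_le_one (v j)
      have h2 := abs_hatFun_sub_le K (x - binCenter K j) (y - binCenter K j)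
      rw [sub_sub_sub_cancel_right] at h2
      nlinarith [abs_nonneg (trit (v j)),
        abs_nonneg (hatFun K (x - binCenter K j) - hatFun K (y - binCenter K j))]
    · have hxm := abs_hardDensityLS_sub_one_le_dist hK v x (j + 1)
      have hym := abs_hardDensityLS_sub_one_le_dist hK v y (j + 1)
      rw [unitBin, mem_Ico] at hj hyj
      push_cast at hxm hym
      grind
  · have : x = y := le_antisymm hxy (hx1 ▸ hy.2)
    simp [this]

theorem lipschitzOnWith_hardDensityLS {K : ℕ} (hK : 0 < K) (v : Fin K → Fin 3) :
    LipschitzOnWith 1 (hardDensityLS K v) (Icc 0 1) := by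
  refine LipschitzOnWith.of_dist_le_mul fun x hx y hy => ?_
  rw [NNReal.coe_one, one_mul, Real.dist_eq, Real.dist_eq]
  rcases le_total x y with h | h
  · exact abs_hardDensityLS_sub_le hK v hx hy h
  · rw [abs_sub_comm, abs_sub_comm x]
    exact abs_hardDensityLS_sub_le hK v hy hx h

theorem measurable_hardDensityLS (K : ℕ) (v : Fin K → Fin 3) :
    Measurable (hardDensityLS K v) := by
  have h : Measurable fun x => 1 + ∑ j : Fin K,
      if x ∈ unitBin K j then trit (v j) * hatFun K (x - binCenter K j) else 0 := by
    refine measurable_const.add (Finset.measurable_sum _ fun j _ =>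
      Measurable.ite (measurableSet_unitBin K j) ?_ measurable_const)
    exact (((continuous_hatFun K).comp (continuous_id.sub continuous_const)).const_mul _).measurable
  simpa only [← hardDensityLS_eq] using h

theorem integrable_hardDensityLS {K : ℕ} (hK : 0 < K) (v : Fin K → Fin 3) :
    IntegrableOn (hardDensityLS K v) (Icc 0 1) := by
  refine Measure.integrableOn_of_bounded (M := 2) (by simp)
    (measurable_hardDensityLS K v).aestronglyMeasurable (Filter.Eventually.of_forall fun x => ?_)
  have := abs_le.1 (abs_hardDensityLS_sub_one_le hK v x)
  rw [Real.norm_eq_abs, abs_le]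
  constructor <;> linarith

theorem integrableOn_ite_unitBin (K j : ℕ) {g : ℝ → ℝ} (hg : Continuous g) :
    IntegrableOn (fun x => if x ∈ unitBin K j then g x else 0) (Icc 0 1) := by
  have h := (hg.integrableOn_Icc (a := 0) (b := 1) (μ := volume)).indicator
    (measurableSet_unitBin K j)
  exact h

theorem setIntegral_ite_unitBin {K : ℕ} (hK : 0 < K) (j : Fin K) (c : ℝ) (g : ℝ → ℝ) :
    (∫ x in Icc (0 : ℝ) 1, if x ∈ unitBin K j then c * g (x - binCenter K j) else 0) =
      c * ∫ x in (-(1 / (2 * (K : ℝ))))..(1 / (2 * (K : ℝ))), g x := by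
  have hK0 : (0 : ℝ) < K := by exact_mod_cast hK
  have h := setIntegral_indicator (μ := volume) (s := Icc (0 : ℝ) 1)
    (f := fun x => c * g (x - binCenter K j)) (measurableSet_unitBin K j)
  rw [inter_eq_right.2 (unitBin_subset_Icc hK j)] at h
  have hle : ((j : ℕ) : ℝ) / (K : ℝ) ≤ (((j : ℕ) : ℝ) + 1) / (K : ℝ) := by gcongr; linarith
  refine Eq.trans h ?_
  rw [unitBin, integral_Ico_eq_integral_Ioc, ← intervalIntegral.integral_of_le hle,
    intervalIntegral.integral_const_mul, intervalIntegral.integral_comp_sub_right (fun x => g x)]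
  congr 2 <;> (rw [binCenter]; field_simp; ring)

theorem setIntegral_sum_unitBin {K : ℕ} (hK : 0 < K) (c : Fin K → ℝ) {g : ℝ → ℝ}
    (hg : Continuous g) :
    (∫ x in Icc (0 : ℝ) 1, ∑ j : Fin K,
      if x ∈ unitBin K j then c j * g (x - binCenter K j) else 0) =
      (∑ j : Fin K, c j) * ∫ x in (-(1 / (2 * (K : ℝ))))..(1 / (2 * (K : ℝ))), g x := by
  rw [integral_finsetSum, Finset.sum_mul]
  · exact Finset.sum_congr rfl fun j _ => setIntegral_ite_unitBin hK j (c j) g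
  · intro j _
    exact integrableOn_ite_unitBin K j (g := fun x => c j * g (x - binCenter K j))
      ((hg.comp (continuous_id.sub continuous_const)).const_mul _)

theorem integral_hardDensityLS {K : ℕ} (hK : 0 < K) (v : Fin K → Fin 3) :
    ∫ x in Icc (0 : ℝ) 1, hardDensityLS K v x = 1 := by
  have h := setIntegral_sum_unitBin hK (fun j => trit (v j)) (continuous_hatFun K)
  rw [integral_hatFun, mul_zero] at h
  have hsub : ∫ x in Icc (0 : ℝ) 1, (hardDensityLS K v x - 1) = 0 := by
    simpa only [hardDensityLS_eq, add_sub_cancel_left] using h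
  rw [integral_sub (integrable_hardDensityLS hK v) (by simp)] at hsub
  simp at hsub
  linarith

theorem tvDist_hardDensityLS {K : ℕ} (hK : 0 < K) (v w : Fin K → Fin 3) :
    tvDist (hardDensityLS K v) (hardDensityLS K w) =
      (∑ j : Fin K, |trit (v j) - trit (w j)|) * (1 / (16 * (K : ℝ) ^ 2)) := by
  have h := setIntegral_sum_unitBin hK (fun j => |trit (v j) - trit (w j)|)
    (continuous_hatFun K).abs
  rw [integral_abs_hatFun] at h
  have hpt : ∀ x, |hardDensityLS K v x - hardDensityLS K w x| = ∑ j : Fin K,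
      if x ∈ unitBin K j then |trit (v j) - trit (w j)| * |hatFun K (x - binCenter K j)|
      else 0 := by
    intro x
    simp only [← abs_mul]
    rw [← abs_sum_unitBin hK fun j x =>
      (trit (v j) - trit (w j)) * hatFun K (x - binCenter K j),
      hardDensityLS_eq, hardDensityLS_eq, add_sub_add_left_eq_sub, ← Finset.sum_sub_distrib]
    congr 1
    refine Finset.sum_congr rfl fun j _ => ?_
    split_ifs <;> ring
  simp only [tvDist, hpt]
  rw [h]
  ring

theorem sum_abs_trit_sub {K : ℕ} (j : Fin K) :
    ∑ v : TritPair K, |trit (v.1 j) - trit (v.2 j)| =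
      (Fintype.card (TritPair K) : ℝ) * (8 / 9) := by
  have hshift : ∀ k : Fin 3 × Fin 3,
      ∑ v : TritPair K, |trit (v.1 j) - trit (v.2 j)| =
        ∑ v : TritPair K, |trit (v.1 j + k.1) - trit (v.2 j + k.2)| := by
    intro k
    exact (Equiv.sum_comp (Equiv.addRight ((fun _ => k.1, fun _ => k.2) : TritPair K))
      fun v : TritPair K => |trit (v.1 j) - trit (v.2 j)|).symm
  have hnine : ∀ a b : Fin 3,
      ∑ k : Fin 3 × Fin 3, |trit (a + k.1) - trit (b + k.2)| = 8 := by
    intro a b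
    refine (Fintype.sum_equiv ((Equiv.addLeft a).prodCongr (Equiv.addLeft b)) _
      (fun k : Fin 3 × Fin 3 => |trit k.1 - trit k.2|) fun _ => rfl).trans ?_
    rw [Fintype.sum_prod_type]
    simp only [Fin.sum_univ_three, trit]
    norm_num
  have hsum : ∑ _k : Fin 3 × Fin 3, ∑ v : TritPair K, |trit (v.1 j) - trit (v.2 j)| =
      (Fintype.card (TritPair K) : ℝ) * 8 := by
    rw [Finset.sum_congr rfl fun k _ => hshift k, Finset.sum_comm,
      Finset.sum_congr rfl fun v _ => hnine (v.1 j) (v.2 j)]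
    simp
  rw [Finset.sum_const, Finset.card_univ, Fintype.card_prod, Fintype.card_fin, nsmul_eq_mul] at hsum
  push_cast at hsum
  linarith

/-- The total variation distance between the two class densities, averaged over the hard family. -/
theorem average_tvDist_hardDensityLS {K : ℕ} (hK : 0 < K) :
    ∑ v : TritPair K, (Fintype.card (TritPair K) : ℝ)⁻¹ *
      tvDist (hardDensityLS K v.1) (hardDensityLS K v.2) = 1 / (18 * (K : ℝ)) := by
  have hK0 : (K : ℝ) ≠ 0 := by exact_mod_cast hK.ne'
  have hN : (Fintype.card (TritPair K) : ℝ) ≠ 0 := by exact_mod_cast Fintype.card_ne_zero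
  rw [← Finset.mul_sum, Finset.sum_congr rfl fun v _ => tvDist_hardDensityLS hK v.1 v.2,
    ← Finset.sum_mul, Finset.sum_comm, Finset.sum_congr rfl fun j _ => sum_abs_trit_sub j,
    Finset.sum_const, Finset.card_univ, Fintype.card_fin, nsmul_eq_mul]
  field_simp
  norm_num

theorem isProbabilityMeasure_labelMeasure {p : ℝ → ℝ} (hp : ∀ x, 0 ≤ p x)
    (h1 : ∫ x in Icc (0 : ℝ) 1, p x = 1) (y : Bool) :
    IsProbabilityMeasure (labelMeasure p y) := by
  have hint : IntegrableOn p (Icc 0 1) := Integrable.of_integral_ne_zero (by rw [h1]; simp)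
  have : IsProbabilityMeasure
      ((volume.restrict (Icc (0 : ℝ) 1)).withDensity fun x => ENNReal.ofReal (p x)) := by
    refine ⟨?_⟩
    rw [withDensity_apply _ MeasurableSet.univ, setLIntegral_univ,
      ← ofReal_integral_eq_lintegral_ofReal hint (Filter.Eventually.of_forall hp), h1]
    simp
  exact Measure.isProbabilityMeasure_map (by fun_prop)

theorem risk_nonneg (f : ℝ → Bool) (P : Measure (ℝ × Bool)) : 0 ≤ risk f P :=
  ENNReal.toReal_nonneg

theorem risk_le_one (f : ℝ → Bool) (P : Measure (ℝ × Bool)) [IsProbabilityMeasure P] :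
    risk f P ≤ 1 :=
  measureReal_le_one

theorem risk_testMeasure (f : ℝ → Bool) (P Q : Measure (ℝ × Bool)) [IsFiniteMeasure P]
    [IsFiniteMeasure Q] :
    risk f (testMeasure P Q) = (1 / 2) * (risk f P + risk f Q) := by
  simp only [risk, testMeasure, Measure.add_apply, Measure.smul_apply, smul_eq_mul]
  rw [ENNReal.toReal_add (ENNReal.mul_ne_top (by simp) (measure_ne_top _ _))
    (ENNReal.mul_ne_top (by simp) (measure_ne_top _ _)), ENNReal.toReal_mul, ENNReal.toReal_mul,
    ENNReal.toReal_inv, ENNReal.toReal_ofNat]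
  ring

theorem isProbabilityMeasure_testMeasure (P Q : Measure (ℝ × Bool)) [IsProbabilityMeasure P]
    [IsProbabilityMeasure Q] : IsProbabilityMeasure (testMeasure P Q) := by
  refine ⟨?_⟩
  simp [testMeasure, ENNReal.inv_two_add_inv_two]

theorem bayesRisk_nonneg (P : Measure (ℝ × Bool)) : 0 ≤ bayesRisk P :=
  Real.iInf_nonneg fun f => risk_nonneg f P

theorem bayesRisk_le_risk (f : ℝ → Bool) (P : Measure (ℝ × Bool)) : bayesRisk P ≤ risk f P :=
  ciInf_le ⟨0, by rintro _ ⟨g, rfl⟩; exact risk_nonneg g P⟩ f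

instance isProbabilityMeasure_sampleMeasure (nmaj nmin : ℕ) (P Q : Measure (ℝ × Bool))
    [IsProbabilityMeasure P] [IsProbabilityMeasure Q] :
    IsProbabilityMeasure (sampleMeasure nmaj nmin P Q) := by
  unfold sampleMeasure
  infer_instance

theorem excessRisk_le_one (nmaj nmin : ℕ) (A : Sample nmaj nmin → ℝ → Bool)
    (P Q : Measure (ℝ × Bool)) [IsProbabilityMeasure P] [IsProbabilityMeasure Q] :
    excessRisk nmaj nmin A P Q ≤ 1 := by
  have := isProbabilityMeasure_testMeasure P Q
  have h : ∫ S, risk (A S) (testMeasure P Q) ∂sampleMeasure nmaj nmin P Q ≤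
      ∫ _S, (1 : ℝ) ∂sampleMeasure nmaj nmin P Q :=
    integral_mono_of_nonneg (Filter.Eventually.of_forall fun S => risk_nonneg _ _)
      (integrable_const _) (Filter.Eventually.of_forall fun S => risk_le_one _ _)
  have hb := bayesRisk_nonneg (testMeasure P Q)
  simp only [integral_const, probReal_univ, smul_eq_mul, mul_one] at h
  rw [excessRisk]
  linarith

theorem bddAbove_excessRisk (nmaj nmin : ℕ) (A : Sample nmaj nmin → ℝ → Bool) :
    BddAbove (range fun P : {P : Measure (ℝ × Bool) × Measure (ℝ × Bool) // memLS P.1 P.2} =>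
      excessRisk nmaj nmin A P.1.1 P.1.2) := by
  refine ⟨1, ?_⟩
  rintro _ ⟨⟨⟨P, Q⟩, p, q, hp, hq, -, -, hp1, hq1, hP, hQ⟩, rfl⟩
  dsimp only at hP hQ ⊢
  have : IsProbabilityMeasure P := hP ▸ isProbabilityMeasure_labelMeasure hp hp1 true
  have : IsProbabilityMeasure Q := hQ ▸ isProbabilityMeasure_labelMeasure hq hq1 false
  exact excessRisk_le_one nmaj nmin A P Q

theorem risk_labelMeasure {p : ℝ → ℝ} (hp : ∀ x, 0 ≤ p x) (hint : IntegrableOn p (Icc 0 1))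
    {f : ℝ → Bool} (hf : Measurable f) (y : Bool) :
    risk f (labelMeasure p y) = ∫ x in Icc (0 : ℝ) 1, if f x = y then 0 else p x := by
  have hset : MeasurableSet {x | f x ≠ y} := (hf (measurableSet_singleton y)).compl
  have hq : MeasurableSet {q : ℝ × Bool | f q.1 ≠ q.2} :=
    (measurableSet_eq_fun (hf.comp measurable_fst) measurable_snd).compl
  have hind : (fun x => if f x = y then 0 else p x) = {x | f x ≠ y}.indicator p := by
    ext x
    by_cases h : f x = y <;> simp [h]
  rw [hind, integral_indicator hset, risk, labelMeasure,
    Measure.map_apply (by fun_prop) hq]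
  change (Measure.withDensity _ _ {x | f x ≠ y}).toReal = _
  rw [withDensity_apply _ hset, ← ofReal_integral_eq_lintegral_ofReal
    (Integrable.restrict (μ := volume.restrict (Icc 0 1)) hint)
    (Filter.Eventually.of_forall hp), ENNReal.toReal_ofReal (integral_nonneg hp)]

/-- On a label-shift pair, a classifier errs by the density of the class it does not predict. -/
theorem risk_testMeasure_labelMeasure {p q : ℝ → ℝ} (hp : ∀ x, 0 ≤ p x) (hq : ∀ x, 0 ≤ q x)
    (hp1 : ∫ x in Icc (0 : ℝ) 1, p x = 1) (hq1 : ∫ x in Icc (0 : ℝ) 1, q x = 1)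
    {f : ℝ → Bool} (hf : Measurable f) :
    risk f (testMeasure (labelMeasure p true) (labelMeasure q false)) =
      (1 / 2) * ∫ x in Icc (0 : ℝ) 1, if f x = true then q x else p x := by
  have := isProbabilityMeasure_labelMeasure hp hp1 true
  have := isProbabilityMeasure_labelMeasure hq hq1 false
  have hpi : IntegrableOn p (Icc 0 1) := Integrable.of_integral_ne_zero (by rw [hp1]; simp)
  have hqi : IntegrableOn q (Icc 0 1) := Integrable.of_integral_ne_zero (by rw [hq1]; simp)
  have hset (y : Bool) : MeasurableSet {x | f x ≠ y} := (hf (measurableSet_singleton y)).compl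
  have hite {r : ℝ → ℝ} (hr : IntegrableOn r (Icc 0 1)) (y : Bool) :
      IntegrableOn (fun x => if f x = y then 0 else r x) (Icc 0 1) := by
    have h := hr.indicator (hset y)
    refine h.congr (Filter.Eventually.of_forall fun x => ?_)
    by_cases h : f x = y <;> simp [h]
  rw [risk_testMeasure, risk_labelMeasure hp hpi hf, risk_labelMeasure hq hqi hf,
    ← integral_add (hite hpi true) (hite hqi false)]
  congr 2
  ext x
  cases h : f x <;> simp

theorem integral_half_add_sub_abs {p q : ℝ → ℝ} (hp : IntegrableOn p (Icc 0 1))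
    (hq : IntegrableOn q (Icc 0 1)) :
    ∫ x in Icc (0 : ℝ) 1, (1 / 2) * ((p x + q x) - |p x - q x|) =
      (1 / 2) * ((∫ x in Icc (0 : ℝ) 1, p x) + ∫ x in Icc (0 : ℝ) 1, q x) - tvDist p q := by
  rw [integral_const_mul, ← integral_add hp hq, tvDist, ← mul_sub]
  exact congrArg _ (integral_sub (hp.add hq) (hp.sub hq).abs)

theorem bayesRisk_testMeasure_labelMeasure_le {p q : ℝ → ℝ} (hp : ∀ x, 0 ≤ p x)
    (hq : ∀ x, 0 ≤ q x) (hpm : Measurable p) (hqm : Measurable q)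
    (hp1 : ∫ x in Icc (0 : ℝ) 1, p x = 1) (hq1 : ∫ x in Icc (0 : ℝ) 1, q x = 1) :
    bayesRisk (testMeasure (labelMeasure p true) (labelMeasure q false)) ≤
      (1 / 2) * (1 - tvDist p q) := by
  have hpi : IntegrableOn p (Icc 0 1) := Integrable.of_integral_ne_zero (by rw [hp1]; simp)
  have hqi : IntegrableOn q (Icc 0 1) := Integrable.of_integral_ne_zero (by rw [hq1]; simp)
  have hf : Measurable fun x => decide (q x ≤ p x) := by
    apply measurable_to_bool
    have : (fun x => decide (q x ≤ p x)) ⁻¹' {true} = {x | q x ≤ p x} := by ext; simp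
    rw [this]
    exact measurableSet_le hqm hpm
  refine (bayesRisk_le_risk (fun x => decide (q x ≤ p x)) _).trans_eq ?_
  rw [risk_testMeasure_labelMeasure hp hq hp1 hq1 hf]
  have hpt : (fun x => if decide (q x ≤ p x) = true then q x else p x) =
      fun x => (1 / 2) * ((p x + q x) - |p x - q x|) := by
    ext x
    rcases le_total (q x) (p x) with h | h
    · rw [abs_of_nonneg (by linarith)]
      simp only [h, decide_true, if_true]
      ring
    · rw [abs_of_nonpos (by linarith)]
      rcases h.lt_or_eq with h' | h'
      · simp only [not_le.2 h', decide_false, Bool.false_eq_true, if_false]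
        ring
      · simp [h']
        ring
  rw [hpt, integral_half_add_sub_abs hpi hqi, hp1, hq1]
  ring

/-- The misclassification probability of any classifier, averaged with weights over label-shift
pairs, is bounded below through the total variation distance of the mixed class densities. -/
theorem le_sum_mul_integral_ite {ι : Type*} [Fintype ι] (w : ι → ℝ) {p q : ι → ℝ → ℝ}
    (hp : ∀ i, ∫ x in Icc (0 : ℝ) 1, p i x = 1) (hq : ∀ i, ∫ x in Icc (0 : ℝ) 1, q i x = 1)
    {f : ℝ → Bool} (hf : Measurable f) :
    (1 / 2) * (∑ i, w i - tvDist (fun x => ∑ i, w i * p i x) (fun x => ∑ i, w i * q i x)) ≤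
      ∑ i, w i * ((1 / 2) * ∫ x in Icc (0 : ℝ) 1, if f x = true then q i x else p i x) := by
  have hpi (i) : IntegrableOn (p i) (Icc 0 1) :=
    Integrable.of_integral_ne_zero (by rw [hp i]; simp)
  have hqi (i) : IntegrableOn (q i) (Icc 0 1) :=
    Integrable.of_integral_ne_zero (by rw [hq i]; simp)
  have hset : MeasurableSet {x | f x = true} := hf (measurableSet_singleton true)
  have hite {r s : ℝ → ℝ} (hr : IntegrableOn r (Icc 0 1)) (hs : IntegrableOn s (Icc 0 1)) :
      IntegrableOn (fun x => if f x = true then r x else s x) (Icc 0 1) := by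
    refine ((hr.indicator hset).add (hs.indicator hset.compl)).congr
      (Filter.Eventually.of_forall fun x => ?_)
    cases h : f x <;> simp [h]
  set P : ℝ → ℝ := fun x => ∑ i, w i * p i x with hP
  set Q : ℝ → ℝ := fun x => ∑ i, w i * q i x with hQ
  have hPi : IntegrableOn P (Icc 0 1) := integrable_finsetSum _ fun i _ => (hpi i).const_mul _
  have hQi : IntegrableOn Q (Icc 0 1) := integrable_finsetSum _ fun i _ => (hqi i).const_mul _
  have hP1 : ∫ x in Icc (0 : ℝ) 1, P x = ∑ i, w i := by
    rw [hP, integral_finsetSum _ fun i _ => (hpi i).const_mul _]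
    simp [integral_const_mul, hp]
  have hQ1 : ∫ x in Icc (0 : ℝ) 1, Q x = ∑ i, w i := by
    rw [hQ, integral_finsetSum _ fun i _ => (hqi i).const_mul _]
    simp [integral_const_mul, hq]
  have hmix : ∑ i, w i * ((1 / 2) * ∫ x in Icc (0 : ℝ) 1, if f x = true then q i x else p i x) =
      (1 / 2) * ∫ x in Icc (0 : ℝ) 1, if f x = true then Q x else P x := by
    have hpt : (fun x => if f x = true then Q x else P x) =
        fun x => ∑ i, w i * if f x = true then q i x else p i x := by
      ext x
      split_ifs <;> rfl
    rw [hpt, integral_finsetSum _ fun i _ => (hite (hqi i) (hpi i)).const_mul _, Finset.mul_sum]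
    refine Finset.sum_congr rfl fun i _ => ?_
    rw [integral_const_mul]
    ring
  have hmono : ∫ x in Icc (0 : ℝ) 1, (1 / 2) * ((P x + Q x) - |P x - Q x|) ≤
      ∫ x in Icc (0 : ℝ) 1, if f x = true then Q x else P x := by
    refine integral_mono (((hPi.add hQi).sub (hPi.sub hQi).abs).const_mul _) (hite hQi hPi)
      fun x => ?_
    dsimp only
    have h1 := le_abs_self (P x - Q x)
    have h2 := neg_abs_le (P x - Q x)
    split_ifs <;> linarith
  rw [integral_half_add_sub_abs hPi hQi, hP1, hQ1] at hmono
  rw [hmix]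
  linarith

theorem memLS_hardDensityLS {K : ℕ} (hK : 0 < K) (v : TritPair K) :
    memLS (labelMeasure (hardDensityLS K v.1) true) (labelMeasure (hardDensityLS K v.2) false) :=
  ⟨hardDensityLS K v.1, hardDensityLS K v.2, hardDensityLS_nonneg hK v.1,
    hardDensityLS_nonneg hK v.2, lipschitzOnWith_hardDensityLS hK v.1,
    lipschitzOnWith_hardDensityLS hK v.2, integral_hardDensityLS hK v.1,
    integral_hardDensityLS hK v.2, rfl, rfl⟩

theorem isProbabilityMeasure_hardLSMeasure {K : ℕ} (hK : 0 < K) (nmaj nmin : ℕ)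
    (v : TritPair K) : IsProbabilityMeasure (hardLSMeasure K nmaj nmin v) := by
  have := isProbabilityMeasure_labelMeasure (hardDensityLS_nonneg hK v.1)
    (integral_hardDensityLS hK v.1) true
  have := isProbabilityMeasure_labelMeasure (hardDensityLS_nonneg hK v.2)
    (integral_hardDensityLS hK v.2) false
  exact isProbabilityMeasure_sampleMeasure nmaj nmin _ _

theorem card_inv_ne_top (K : ℕ) : (Fintype.card (TritPair K) : ℝ≥0∞)⁻¹ ≠ ∞ :=
  ENNReal.inv_ne_top.2 (by exact_mod_cast Fintype.card_ne_zero)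

theorem isFiniteMeasure_hardLSMarginal {K : ℕ} (hK : 0 < K) (nmaj nmin : ℕ) :
    IsFiniteMeasure (hardLSMarginal K nmaj nmin) := by
  have := isProbabilityMeasure_hardLSMeasure hK nmaj nmin
  have (v : TritPair K) : IsFiniteMeasure
      ((Fintype.card (TritPair K) : ℝ≥0∞)⁻¹ • hardLSMeasure K nmaj nmin v) :=
    Measure.smul_finite _ (card_inv_ne_top K)
  unfold hardLSMarginal
  infer_instance

theorem absolutelyContinuous_hardLSMarginal (K nmaj nmin : ℕ) (v : TritPair K) :
    (Fintype.card (TritPair K) : ℝ≥0∞)⁻¹ • hardLSMeasure K nmaj nmin v ≪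
      hardLSMarginal K nmaj nmin := by
  refine Measure.AbsolutelyContinuous.mk fun s _ hs => ?_
  rw [hardLSMarginal, Measure.finsetSum_apply, Finset.sum_eq_zero_iff] at hs
  exact hs v (Finset.mem_univ v)

theorem integrable_postLS {K : ℕ} (hK : 0 < K) (nmaj nmin : ℕ) (v : TritPair K) :
    Integrable (postLS K nmaj nmin v) (hardLSMarginal K nmaj nmin) := by
  have := isProbabilityMeasure_hardLSMeasure hK nmaj nmin v
  have : IsFiniteMeasure ((Fintype.card (TritPair K) : ℝ≥0∞)⁻¹ • hardLSMeasure K nmaj nmin v) :=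
    Measure.smul_finite _ (card_inv_ne_top K)
  exact Measure.integrable_toReal_rnDeriv

theorem integral_postLS_mul {K : ℕ} (hK : 0 < K) (nmaj nmin : ℕ) (v : TritPair K)
    (g : Sample nmaj nmin → ℝ) :
    ∫ S, postLS K nmaj nmin v S * g S ∂hardLSMarginal K nmaj nmin =
      (Fintype.card (TritPair K) : ℝ)⁻¹ * ∫ S, g S ∂hardLSMeasure K nmaj nmin v := by
  have := isFiniteMeasure_hardLSMarginal hK nmaj nmin
  have := isProbabilityMeasure_hardLSMeasure hK nmaj nmin v
  have : IsFiniteMeasure ((Fintype.card (TritPair K) : ℝ≥0∞)⁻¹ • hardLSMeasure K nmaj nmin v) :=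
    Measure.smul_finite _ (card_inv_ne_top K)
  have h := integral_rnDeriv_smul (absolutelyContinuous_hardLSMarginal K nmaj nmin v) (f := g)
  rw [integral_smul_measure, ENNReal.toReal_inv, ENNReal.toReal_natCast] at h
  exact h

theorem integrable_tvDist_postMixLS {K : ℕ} (hK : 0 < K) (nmaj nmin : ℕ) :
    Integrable (fun S => tvDist (postMixLS K nmaj nmin S true) (postMixLS K nmaj nmin S false))
      (hardLSMarginal K nmaj nmin) := by
  have := isFiniteMeasure_hardLSMarginal hK nmaj nmin
  have hmix (b : Bool) : Integrable
      (fun z : Sample nmaj nmin × ℝ => postMixLS K nmaj nmin z.1 b z.2)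
      ((hardLSMarginal K nmaj nmin).prod (volume.restrict (Icc 0 1))) :=
    integrable_finsetSum _ fun v _ =>
      (integrable_postLS hK nmaj nmin v).mul_prod (integrable_hardDensityLS hK _)
  exact ((hmix true).sub (hmix false)).abs.integral_prod_left.const_mul (1 / 2)

/-- The risk of the trained classifier `A S` on the hard label-shift instance `v`. -/
def hardRiskLS {K nmaj nmin : ℕ} (A : Sample nmaj nmin → ℝ → Bool) (v : TritPair K)
    (S : Sample nmaj nmin) : ℝ :=
  risk (A S) (testMeasure (labelMeasure (hardDensityLS K v.1) true)
    (labelMeasure (hardDensityLS K v.2) false))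

theorem MeasurableAlg.measurable_classifier {nmaj nmin : ℕ} {A : Sample nmaj nmin → ℝ → Bool}
    (hA : MeasurableAlg nmaj nmin A) (S : Sample nmaj nmin) : Measurable (A S) :=
  hA.comp measurable_prodMk_left

theorem hardRiskLS_eq {K nmaj nmin : ℕ} (hK : 0 < K) {A : Sample nmaj nmin → ℝ → Bool}
    (hA : MeasurableAlg nmaj nmin A) (v : TritPair K) (S : Sample nmaj nmin) :
    hardRiskLS A v S = (1 / 2) * ∫ x in Icc (0 : ℝ) 1,
      if A S x = true then hardDensityLS K v.2 x else hardDensityLS K v.1 x :=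
  risk_testMeasure_labelMeasure (hardDensityLS_nonneg hK v.1) (hardDensityLS_nonneg hK v.2)
    (integral_hardDensityLS hK v.1) (integral_hardDensityLS hK v.2) (hA.measurable_classifier S)

theorem measurable_hardRiskLS {K nmaj nmin : ℕ} (hK : 0 < K) {A : Sample nmaj nmin → ℝ → Bool}
    (hA : MeasurableAlg nmaj nmin A) (v : TritPair K) : Measurable (hardRiskLS A v) := by
  have hF : Measurable fun z : Sample nmaj nmin × ℝ =>
      if A z.1 z.2 = true then hardDensityLS K v.2 z.2 else hardDensityLS K v.1 z.2 :=
    Measurable.ite (hA (measurableSet_singleton true))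
      ((measurable_hardDensityLS K v.2).comp measurable_snd)
      ((measurable_hardDensityLS K v.1).comp measurable_snd)
  have h := hF.stronglyMeasurable.integral_prod_right' (ν := volume.restrict (Icc (0 : ℝ) 1))
  rw [funext (hardRiskLS_eq hK hA v)]
  exact h.measurable.const_mul _

theorem integrable_postLS_mul_hardRiskLS {K nmaj nmin : ℕ} (hK : 0 < K)
    {A : Sample nmaj nmin → ℝ → Bool} (hA : MeasurableAlg nmaj nmin A) (v : TritPair K) :
    Integrable (fun S => postLS K nmaj nmin v S * hardRiskLS A v S)
      (hardLSMarginal K nmaj nmin) := by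
  have := isProbabilityMeasure_labelMeasure (hardDensityLS_nonneg hK v.1)
    (integral_hardDensityLS hK v.1) true
  have := isProbabilityMeasure_labelMeasure (hardDensityLS_nonneg hK v.2)
    (integral_hardDensityLS hK v.2) false
  have := isProbabilityMeasure_testMeasure (labelMeasure (hardDensityLS K v.1) true)
    (labelMeasure (hardDensityLS K v.2) false)
  refine (integrable_postLS hK nmaj nmin v).mul_bdd (c := 1)
    (measurable_hardRiskLS hK hA v).aestronglyMeasurable (Filter.Eventually.of_forall fun S => ?_)
  rw [Real.norm_eq_abs, hardRiskLS, abs_of_nonneg (risk_nonneg _ _)]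
  exact risk_le_one _ _

/-- The Bayesian average risk over the hard family is at least that of the Bayes classifier for the
posterior mixtures. -/
theorem le_average_hardRiskLS {K nmaj nmin : ℕ} (hK : 0 < K) {A : Sample nmaj nmin → ℝ → Bool}
    (hA : MeasurableAlg nmaj nmin A) :
    1 / 2 - (1 / 2) *
        (∫ S, tvDist (postMixLS K nmaj nmin S true) (postMixLS K nmaj nmin S false)
          ∂hardLSMarginal K nmaj nmin) ≤
      ∑ v : TritPair K, (Fintype.card (TritPair K) : ℝ)⁻¹ *
        ∫ S, hardRiskLS A v S ∂hardLSMeasure K nmaj nmin v := by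
  have hN : (Fintype.card (TritPair K) : ℝ) ≠ 0 := by exact_mod_cast Fintype.card_ne_zero
  have hpost : Integrable (fun S => ∑ v : TritPair K, postLS K nmaj nmin v S)
      (hardLSMarginal K nmaj nmin) :=
    integrable_finsetSum _ fun v _ => integrable_postLS hK nmaj nmin v
  have htv := integrable_tvDist_postMixLS hK nmaj nmin
  have hmass (v : TritPair K) : ∫ S, postLS K nmaj nmin v S ∂hardLSMarginal K nmaj nmin =
      (Fintype.card (TritPair K) : ℝ)⁻¹ := by
    have := isProbabilityMeasure_hardLSMeasure hK nmaj nmin v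
    simpa using integral_postLS_mul hK nmaj nmin v fun _ => 1
  have hmass_sum : ∫ S, ∑ v : TritPair K, postLS K nmaj nmin v S
      ∂hardLSMarginal K nmaj nmin = 1 := by
    rw [integral_finsetSum _ fun v _ => integrable_postLS hK nmaj nmin v,
      Finset.sum_congr rfl fun v _ => hmass v, Finset.sum_const, Finset.card_univ, nsmul_eq_mul,
      mul_inv_cancel₀ hN]
  have hmono := integral_mono ((hpost.sub htv).const_mul (1 / 2))
    (integrable_finsetSum Finset.univ fun v _ => integrable_postLS_mul_hardRiskLS hK hA v)
    fun S => by
      simp only [hardRiskLS_eq hK hA]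
      exact le_sum_mul_integral_ite (fun v : TritPair K => postLS K nmaj nmin v S)
        (fun v => integral_hardDensityLS hK v.1) (fun v => integral_hardDensityLS hK v.2)
        (hA.measurable_classifier S)
  rw [integral_const_mul, integral_sub' hpost htv, hmass_sum,
    integral_finsetSum _ fun v _ => integrable_postLS_mul_hardRiskLS hK hA v,
    Finset.sum_congr rfl fun v _ => integral_postLS_mul hK nmaj nmin v (hardRiskLS A v)] at hmono
  linarith

/-- **Lemma (label-shift lower-bound decomposition).** For any positive integers
`K, n_maj, n_min`, the minimax excess risk over `𝒫_LS` is at least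
`1/(36K) - (1/2) E_{S ~ Q_S}[TV(Σ_v Q(v|S) P_{v,1}, Σ_v Q(v|S) P_{v,-1})]`,
for the hard label-shift family. -/
theorem label_shift_lower_bound_decomposition
    (K nmaj nmin : ℕ) (hK : 0 < K) (hmin : 1 ≤ nmin) (hmaj : nmin < nmaj)
    (A : Sample nmaj nmin → ℝ → Bool) (hA : MeasurableAlg nmaj nmin A) :
    1/(36*(K:ℝ)) - (1/2) *
        (∫ S, tvDist (postMixLS K nmaj nmin S true) (postMixLS K nmaj nmin S false)
          ∂hardLSMarginal K nmaj nmin)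
      ≤ ⨆ P : {P : Measure (ℝ × Bool) × Measure (ℝ × Bool) // memLS P.1 P.2},
          excessRisk nmaj nmin A P.1.1 P.1.2 := by
  have hN : (Fintype.card (TritPair K) : ℝ) ≠ 0 := by exact_mod_cast Fintype.card_ne_zero
  set M := ⨆ P : {P : Measure (ℝ × Bool) × Measure (ℝ × Bool) // memLS P.1 P.2},
    excessRisk nmaj nmin A P.1.1 P.1.2
  have hexcess (v : TritPair K) :
      (∫ S, hardRiskLS A v S ∂hardLSMeasure K nmaj nmin v) -
        (1 / 2) * (1 - tvDist (hardDensityLS K v.1) (hardDensityLS K v.2)) ≤ M := by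
    refine le_trans ?_ (le_ciSup (bddAbove_excessRisk nmaj nmin A) ⟨(_, _), memLS_hardDensityLS hK v⟩)
    exact sub_le_sub_left (bayesRisk_testMeasure_labelMeasure_le (hardDensityLS_nonneg hK v.1)
      (hardDensityLS_nonneg hK v.2) (measurable_hardDensityLS K v.1)
      (measurable_hardDensityLS K v.2) (integral_hardDensityLS hK v.1)
      (integral_hardDensityLS hK v.2)) _
  have havg : ∑ v : TritPair K, (Fintype.card (TritPair K) : ℝ)⁻¹ *
      ((∫ S, hardRiskLS A v S ∂hardLSMeasure K nmaj nmin v) -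
        (1 / 2) * (1 - tvDist (hardDensityLS K v.1) (hardDensityLS K v.2))) ≤
      ∑ _v : TritPair K, (Fintype.card (TritPair K) : ℝ)⁻¹ * M := by
    gcongr with v
    exact hexcess v
  have hone : ∑ _v : TritPair K, (Fintype.card (TritPair K) : ℝ)⁻¹ = 1 := by
    rw [Finset.sum_const, Finset.card_univ, nsmul_eq_mul, mul_inv_cancel₀ hN]
  rw [← Finset.sum_mul, hone, one_mul] at havg
  refine le_trans ?_ havg
  have hsplit : ∑ v : TritPair K, (Fintype.card (TritPair K) : ℝ)⁻¹ *
      ((∫ S, hardRiskLS A v S ∂hardLSMeasure K nmaj nmin v) -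
        (1 / 2) * (1 - tvDist (hardDensityLS K v.1) (hardDensityLS K v.2))) =
      ∑ v : TritPair K, (Fintype.card (TritPair K) : ℝ)⁻¹ *
        (∫ S, hardRiskLS A v S ∂hardLSMeasure K nmaj nmin v) -
      (1 / 2) * (∑ _v : TritPair K, (Fintype.card (TritPair K) : ℝ)⁻¹ -
        ∑ v : TritPair K, (Fintype.card (TritPair K) : ℝ)⁻¹ *
          tvDist (hardDensityLS K v.1) (hardDensityLS K v.2)) := by
    rw [← Finset.sum_sub_distrib, Finset.mul_sum, ← Finset.sum_sub_distrib]
    refine Finset.sum_congr rfl fun v _ => ?_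
    ring
  rw [hsplit, hone, average_tvDist_hardDensityLS hK]
  have hrisk := le_average_hardRiskLS hK hA
  have hconst : 1 / (36 * (K : ℝ)) = (1 / 2) * (1 / (18 * (K : ℝ))) := by ring
  rw [hconst]
  linarith
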